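/- Let σ1, σ2 > 0, ρ ∈ (−1,1), and let α1, α2 be real numbers with α1 > 2 and 0 < α2 < 2 (or symmetrically 0 < α1 < 2 and α2 > 2). Then E[|X1|^{α1}|X2|^{α2}] − E[|X1|^{α1}]·E[|X2|^{α2}] ≥ (2^{(α1+α2)/2} α1 α2 σ1^{α1} σ2^{α2} ρ² / (4√π)) · Γ((α1+α2−1)/2). -/

import Mathlib

open MeasureTheory Real

/-- Centered bivariate Gaussian density with variances σ₁², σ₂² and correlation ρ. -/
noncomputable def gaussDensity2 (σ₁ σ₂ ρ x y : ℝ) : ℝ :=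
  (2 * π * σ₁ * σ₂ * Real.sqrt (1 - ρ ^ 2))⁻¹ *
    Real.exp (-(x ^ 2 / σ₁ ^ 2 - 2 * ρ * x * y / (σ₁ * σ₂) + y ^ 2 / σ₂ ^ 2) /
      (2 * (1 - ρ ^ 2)))

/-- E[|X₁|^a |X₂|^b] for the centered bivariate Gaussian. -/
noncomputable def E2 (σ₁ σ₂ ρ a b : ℝ) : ℝ :=
  ∫ q : ℝ × ℝ, |q.1| ^ a * |q.2| ^ b * gaussDensity2 σ₁ σ₂ ρ q.1 q.2

/-- E[|X|^a] for a centered Gaussian with variance σ². -/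
noncomputable def E1 (σ a : ℝ) : ℝ :=
  ∫ x : ℝ, |x| ^ a * (Real.sqrt (2 * π * σ ^ 2))⁻¹ * Real.exp (-x ^ 2 / (2 * σ ^ 2))

open Finset Filter Topology

theorem hasSum_prod_div_factorial_mul_pow (r : ℝ) {t : ℝ} (ht : |t| < 1) :
    HasSum (fun k : ℕ => (∏ j ∈ range k, (r + j)) / k.factorial * t ^ k) ((1 - t) ^ (-r)) := by
  have h := (one_div_one_sub_rpow_hasFPowerSeriesOnBall_zero r).hasSum (y := t) (by
    simpa [enorm_eq_nnnorm, ← NNReal.coe_lt_coe] using ht)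
  have h1 : 0 ≤ 1 - t := by linarith [(abs_lt.mp ht).2]
  convert! h using 1
  · ext k
    have hk : (k.factorial : ℝ) ≠ 0 := by positivity
    have hc := Ring.factorial_nsmul_multichoose_eq_ascPochhammer r k
    rw [Polynomial.ascPochhammer_smeval_eq_eval, nsmul_eq_mul] at hc
    have hprod : (ascPochhammer ℝ k).eval r = ∏ j ∈ range k, (r + j) := by
      clear hk hc
      induction k with
      | zero => simp
      | succ k ih => rw [ascPochhammer_succ_eval, prod_range_succ, ih]
    rw [hprod] at hc
    simp only [FormalMultilinearSeries.ofScalars_apply_eq, smul_eq_mul, Ring.choose]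
    rw [← hc, show r + k - 1 - k + 1 = r by ring]
    field_simp
  · simp [rpow_neg h1]

/-- The partial products converge to a quotient of Gamma values. -/
theorem tendsto_prod_ratio_Gamma {p q s : ℝ} (hp : 0 < p) (hq : 0 < q) (hs : 0 < s)
    (hpq : p + q = 3 / 2 + s) :
    Tendsto (fun k : ℕ => ∏ j ∈ range k, ((p + j) * (q + j) / ((3 / 2 + j) * (s + j)))) atTop
      (𝓝 (Gamma (3 / 2) * Gamma s / (Gamma p * Gamma q))) := by
  rw [← tendsto_add_atTop_iff_nat 1]
  have h := ((GammaSeq_tendsto_Gamma (3 / 2)).mul (GammaSeq_tendsto_Gamma s)).div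
    ((GammaSeq_tendsto_Gamma p).mul (GammaSeq_tendsto_Gamma q))
    (mul_pos (Gamma_pos_of_pos hp) (Gamma_pos_of_pos hq)).ne'
  refine h.congr' ?_
  filter_upwards [eventually_gt_atTop 0] with n hn
  have hn' : (0 : ℝ) < n := by exact_mod_cast hn
  have hpow : (n : ℝ) ^ p * (n : ℝ) ^ q = (n : ℝ) ^ (3 / 2 : ℝ) * (n : ℝ) ^ s := by
    rw [← rpow_add hn', ← rpow_add hn', hpq]
  have hf : (n.factorial : ℝ) ≠ 0 := by positivity
  have hprod : ∀ x : ℝ, 0 < x → ∏ j ∈ range (n + 1), (x + j) ≠ 0 := fun x hx =>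
    (prod_pos fun j _ => by positivity).ne'
  have h1 := hprod p hp
  have h2 := hprod q hq
  have h3 := hprod s hs
  have h4 := hprod (3 / 2) (by norm_num)
  have h5 : (n : ℝ) ^ p ≠ 0 := (rpow_pos_of_pos hn' _).ne'
  have h6 : (n : ℝ) ^ q ≠ 0 := (rpow_pos_of_pos hn' _).ne'
  simp only [Pi.div_apply, GammaSeq, prod_div_distrib, prod_mul_distrib]
  generalize ∏ j ∈ range (n + 1), (p + (j : ℝ)) = A at *
  generalize ∏ j ∈ range (n + 1), (q + (j : ℝ)) = B at *
  generalize ∏ j ∈ range (n + 1), (s + (j : ℝ)) = C at *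
  generalize ∏ j ∈ range (n + 1), (3 / 2 + (j : ℝ)) = D at *
  rw [div_mul_div_comm, div_mul_div_comm, div_div_div_eq, div_eq_div_iff (by positivity)
    (by positivity)]
  linear_combination (-(n.factorial : ℝ) ^ 2 * A * B * D * C) * hpow

section MixedRange

variable {p q s lim : ℝ}

theorem prod_ratio_pos (hp : 0 < p) (hq : 0 < q) (hs : 0 < s) (k : ℕ) :
    0 < ∏ j ∈ range k, ((p + j) * (q + j) / ((3 / 2 + j) * (s + j))) :=
  prod_pos fun j _ => by positivity

/-- A lower bound for the limit of the partial products. -/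
theorem one_le_mul_of_tendsto_prod_ratio (hp : 1 / 2 < p) (hq : 1 / 2 < q)
    (hpq : (p - 3 / 2) * (q - 3 / 2) < 0) (hs : 0 < s) (hsum : p + q = 3 / 2 + s)
    (hlim : Tendsto (fun k : ℕ => ∏ j ∈ range k, ((p + j) * (q + j) / ((3 / 2 + j) * (s + j))))
      atTop (𝓝 lim)) :
    1 ≤ lim * (1 - 2 * ((p - 3 / 2) * (q - 3 / 2))) := by
  set m := -((p - 3 / 2) * (q - 3 / 2)) with hm
  have hm0 : 0 < m := by linarith
  have key : ∀ k : ℕ, 1 + m / (k + 1 / 2) ≤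
      (∏ j ∈ range k, ((p + j) * (q + j) / ((3 / 2 + j) * (s + j)))) * (1 + 2 * m) := by
    intro k
    induction k with
    | zero => simp; linarith
    | succ k ih =>
      rw [prod_range_succ]
      have hk : (0 : ℝ) ≤ k := k.cast_nonneg
      have hR : 0 < (p + k) * (q + k) / ((3 / 2 + k) * (s + k)) := by positivity
      have hstep : 1 + m / ((k : ℝ) + 1 + 1 / 2) ≤
          (1 + m / (k + 1 / 2)) * ((p + k) * (q + k) / ((3 / 2 + k) * (s + k))) := by
        have h1 : (p + k) * (q + k) = (3 / 2 + k) * (s + k) - m := by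
          rw [hm]; linear_combination ((3 / 2 : ℝ) + k) * hsum
        have h2 : 0 < (3 / 2 + (k : ℝ)) * (s + k) := by positivity
        have e : (1 + m / (k + 1 / 2)) * ((p + k) * (q + k) / ((3 / 2 + k) * (s + k)))
            - (1 + m / ((k : ℝ) + 1 + 1 / 2)) =
            m * ((p - 1 / 2) * (q - 1 / 2)) / ((k + 1 / 2) * ((3 / 2 + k) * (s + k))) := by
          have h3 : s = p + q - 3 / 2 := by linarith
          have h4 : ((k : ℝ) + 1 + 1 / 2) = 3 / 2 + k := by ring
          have h5 : (k : ℝ) + 1 / 2 ≠ 0 := by positivity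
          have h6 : (3 / 2 : ℝ) + k ≠ 0 := by positivity
          have h7 : s + k ≠ 0 := by positivity
          rw [h4, h1]
          field_simp
          have h8 : m = -((p - 3 / 2) * (q - 3 / 2)) := hm
          rw [h3, h8]
          ring
        have : 0 ≤ m * ((p - 1 / 2) * (q - 1 / 2)) /
            ((k + 1 / 2) * ((3 / 2 + k) * (s + k))) := by
          have : 0 < p - 1 / 2 := by linarith
          have : 0 < q - 1 / 2 := by linarith
          positivity
        linarith
      calc 1 + m / (((k + 1 : ℕ) : ℝ) + 1 / 2) = 1 + m / ((k : ℝ) + 1 + 1 / 2) := by push_cast; rfl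
        _ ≤ _ := hstep
        _ ≤ _ := mul_le_mul_of_nonneg_right ih hR.le
        _ = _ := by ring
  have h := ge_of_tendsto' (hlim.mul_const (1 + 2 * m)) fun k : ℕ =>
    (le_add_of_nonneg_right (by positivity : 0 ≤ m / ((k : ℝ) + 1 / 2))).trans (key k)
  calc 1 ≤ _ := h
    _ = _ := by rw [hm]; ring

theorem antitone_prod_ratio_mul (hp : 1 / 2 < p) (hq : 1 / 2 < q)
    (hpq : (p - 3 / 2) * (q - 3 / 2) < 0) (hs : 0 < s) (hsum : p + q = 3 / 2 + s) :
    Antitone fun k : ℕ => (∏ j ∈ range k, ((p + j) * (q + j) / ((3 / 2 + j) * (s + j)))) *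
      ((k + ((p - 1 / 2) * (q - 1 / 2) + 1 / 2)) / (k + s)) := by
  refine antitone_nat_of_succ_le fun k => ?_
  have hP := prod_ratio_pos (p := p) (q := q) (by linarith) (by linarith) hs k
  have hκ : 0 < (p - 1 / 2) * (q - 1 / 2) := mul_pos (by linarith) (by linarith)
  set κ := (p - 1 / 2) * (q - 1 / 2) + 1 / 2 with hκd
  have hκ0 : 0 < κ := by linarith
  rw [prod_range_succ, mul_assoc]
  refine mul_le_mul_of_nonneg_left ?_ hP.le
  have hk : (0 : ℝ) ≤ k := k.cast_nonneg
  push_cast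
  rw [div_mul_div_comm, div_le_div_iff₀ (by positivity) (by positivity)]
  have e : (k + κ) * ((3 / 2 + k) * (s + k) * (k + 1 + s)) -
      (p + k) * (q + k) * (k + 1 + κ) * (k + s) =
      (k + s) * (-((p - 3 / 2) * (q - 3 / 2)) * ((p - 1 / 2) * (q - 1 / 2))) := by
    rw [hκd, show s = p + q - 3 / 2 by linarith]
    ring
  have : 0 ≤ (k + s) * (-((p - 3 / 2) * (q - 3 / 2)) * ((p - 1 / 2) * (q - 1 / 2))) :=
    mul_nonneg (by positivity) (mul_nonneg (by linarith) hκ.le)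
  linarith

theorem add_mul_le_mul_prod_ratio (hp : 1 / 2 < p) (hq : 1 / 2 < q)
    (hpq : (p - 3 / 2) * (q - 3 / 2) < 0) (hs : 0 < s) (hsum : p + q = 3 / 2 + s)
    (hlim : Tendsto (fun k : ℕ => ∏ j ∈ range k, ((p + j) * (q + j) / ((3 / 2 + j) * (s + j))))
      atTop (𝓝 lim)) (k : ℕ) :
    s + k * (1 + 2 * ((p - 1 / 2) * (q - 1 / 2)) * lim) ≤
      2 * s * (k + 1 / 2) * ∏ j ∈ range k, ((p + j) * (q + j) / ((3 / 2 + j) * (s + j))) := by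
  have hlimit : 1 + 2 * ((p - 1 / 2) * (q - 1 / 2)) * lim ≤ 2 * s * lim := by
    have := one_le_mul_of_tendsto_prod_ratio hp hq hpq hs hsum hlim
    rw [show s = p + q - 3 / 2 by linarith]
    linarith
  have hquot : Tendsto (fun k : ℕ => ((k : ℝ) + ((p - 1 / 2) * (q - 1 / 2) + 1 / 2)) / (k + s))
      atTop (𝓝 1) := by
    have h : Tendsto (fun k : ℕ => 1 + ((p - 1 / 2) * (q - 1 / 2) + 1 / 2 - s) / ((k : ℝ) + s))
        atTop (𝓝 (1 + 0)) :=
      tendsto_const_nhds.add (tendsto_const_nhds.div_atTop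
        (tendsto_atTop_add_const_right _ _ tendsto_natCast_atTop_atTop))
    rw [add_zero] at h
    refine h.congr fun k => ?_
    have : (k : ℝ) + s ≠ 0 := by positivity
    field_simp
    ring
  have hge := (antitone_prod_ratio_mul hp hq hpq hs hsum).le_of_tendsto
    (by simpa using hlim.mul hquot)
  induction k with
  | zero => simp; linarith
  | succ k ih =>
    have hk := hge k
    have e : ∀ P : ℝ, 2 * s * ((k : ℝ) + 1 + 1 / 2) *
        (P * ((p + k) * (q + k) / ((3 / 2 + k) * (s + k)))) =
        2 * s * (k + 1 / 2) * P +
          2 * s * (P * ((k + ((p - 1 / 2) * (q - 1 / 2) + 1 / 2)) / (k + s))) := by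
      intro P
      have h6 : (3 / 2 : ℝ) + k ≠ 0 := by positivity
      have h7 : s + k ≠ 0 := by positivity
      have h8 : (k : ℝ) + s ≠ 0 := by positivity
      rw [show (k : ℝ) + 1 + 1 / 2 = 3 / 2 + k by ring, add_comm (k : ℝ) s]
      field_simp
      rw [show s = p + q - 3 / 2 by linarith]
      ring
    rw [prod_range_succ]
    push_cast
    rw [e]
    have h2 := mul_le_mul_of_nonneg_left hk (by positivity : 0 ≤ 2 * s)
    linarith

theorem Gamma_add_natCast_eq_prod {x : ℝ} (hx : 0 < x) (k : ℕ) :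
    Gamma (x + k) = (∏ j ∈ range k, (x + j)) * Gamma x := by
  induction k with
  | zero => simp
  | succ k ih =>
    rw [prod_range_succ, Nat.cast_succ, ← add_assoc, Gamma_add_one (by positivity), ih]
    ring

theorem factorial_two_mul_eq_prod (k : ℕ) :
    ((2 * k).factorial : ℝ) * (k + 1 / 2) = 4 ^ k * k.factorial *
      (1 / 2 * ∏ j ∈ range k, ((3 / 2 : ℝ) + j)) := by
  induction k with
  | zero => simp
  | succ k ih =>
    rw [prod_range_succ, show 2 * (k + 1) = 2 * k + 1 + 1 by ring, Nat.factorial_succ,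
      Nat.factorial_succ, Nat.factorial_succ]
    push_cast
    linear_combination (2 * (k + 1) * (2 * k + 3)) * ih

/-- Coefficientwise comparison of the moment series with a binomial series. -/
theorem coeff_le_Gamma_mul_Gamma (hp : 1 / 2 < p) (hq : 1 / 2 < q)
    (hpq : (p - 3 / 2) * (q - 3 / 2) < 0) (hs : 0 < s) (hsum : p + q = 3 / 2 + s) (k : ℕ) :
    (∏ j ∈ range k, (s + j)) / (s * k.factorial) * (Gamma p * Gamma q * (s + k) +
      k * (√π * ((p - 1 / 2) * (q - 1 / 2)) * Gamma s)) ≤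
      Gamma (p + k) * Gamma (q + k) * 4 ^ k / (2 * k).factorial := by
  have hp0 : 0 < p := by linarith
  have hq0 : 0 < q := by linarith
  have hΓp := Gamma_pos_of_pos hp0
  have hΓq := Gamma_pos_of_pos hq0
  have h := add_mul_le_mul_prod_ratio hp hq hpq hs hsum
    (tendsto_prod_ratio_Gamma hp0 hq0 hs hsum) k
  have hΓ : Gamma (3 / 2) = √π / 2 := by
    rw [show (3 / 2 : ℝ) = 1 / 2 + 1 by norm_num, Gamma_add_one (by norm_num), Gamma_one_half_eq]
    ring
  have hS : 0 < ∏ j ∈ range k, (s + j) := prod_pos fun j _ => by positivity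
  have hT : 0 < ∏ j ∈ range k, ((3 / 2 : ℝ) + j) := prod_pos fun j _ => by positivity
  have hfac := factorial_two_mul_eq_prod k
  rw [Gamma_add_natCast_eq_prod hp0, Gamma_add_natCast_eq_prod hq0]
  simp only [prod_div_distrib, prod_mul_distrib, hΓ] at h
  generalize ∏ j ∈ range k, (s + (j : ℝ)) = S at *
  generalize ∏ j ∈ range k, ((3 / 2 : ℝ) + j) = T at *
  generalize ∏ j ∈ range k, (p + (j : ℝ)) = A at *
  generalize ∏ j ∈ range k, (q + (j : ℝ)) = B at *
  have hF : (0 : ℝ) < (2 * k).factorial := by positivity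
  have hf : (0 : ℝ) < k.factorial := by positivity
  have h2 := mul_le_mul_of_nonneg_left h
    (by positivity : 0 ≤ S / (s * k.factorial) * (Gamma p * Gamma q))
  convert! h2 using 1
  · field_simp
    ring
  · have hF' : ((2 * k).factorial : ℝ) =
        4 ^ k * k.factorial * (1 / 2 * T) / (k + 1 / 2) := by
      rw [← hfac]; field_simp
    rw [hF']
    field_simp

theorem hasSum_coeff (hs : 0 < s) (c d : ℝ) {t : ℝ} (ht : |t| < 1) :
    HasSum (fun k : ℕ => (∏ j ∈ range k, (s + j)) / (s * k.factorial) *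
      (c * (s + k) + k * d) * t ^ k) ((c + d * t) * (1 - t) ^ (-(s + 1))) := by
  have hb := hasSum_prod_div_factorial_mul_pow (s + 1) ht
  have hprod : ∀ k : ℕ, (∏ j ∈ range k, (s + j)) * (s + k) =
      s * ∏ j ∈ range k, (s + 1 + j) := by
    intro k
    rw [← prod_range_succ, prod_range_succ']
    simp [mul_comm, add_assoc, add_comm (1 : ℝ)]
  have h1 : HasSum (fun k : ℕ => (∏ j ∈ range k, (s + j)) / (s * k.factorial) *
      (k * d) * t ^ k) (d * t * (1 - t) ^ (-(s + 1))) := by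
    rw [← hasSum_nat_add_iff' 1]
    simp only [range_one, sum_singleton, Nat.cast_zero, zero_mul, mul_zero, sub_zero]
    convert! hb.mul_left (d * t) using 1
    ext k
    rw [prod_range_succ, hprod, Nat.factorial_succ, pow_succ]
    have hk : (k.factorial : ℝ) ≠ 0 := by positivity
    push_cast
    field_simp
  convert! (hb.mul_left c).add h1 using 1
  · ext k
    have hk : (k.factorial : ℝ) ≠ 0 := by positivity
    field_simp
    linear_combination c * t ^ k * hprod k
  · ring

end MixedRange

theorem integral_abs_rpow_mul_exp_neg_mul_sq {b c : ℝ} (hb : 0 < b) (hc : -1 < c) :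
    ∫ x : ℝ, |x| ^ c * exp (-b * x ^ 2) = b ^ (-((c + 1) / 2)) * Gamma ((c + 1) / 2) := by
  have h := integral_rpow_mul_exp_neg_mul_rpow (p := 2) two_pos hc hb
  have h' := integral_comp_abs (f := fun x => x ^ c * exp (-b * x ^ (2 : ℝ)))
  simp only [rpow_two, sq_abs] at h h'
  rw [h', h, neg_div]
  ring

theorem integrable_abs_rpow_mul_exp_neg_mul_sq {b c : ℝ} (hb : 0 < b) (hc : -1 < c) :
    Integrable fun x : ℝ => |x| ^ c * exp (-b * x ^ 2) := by
  refine Integrable.of_integral_ne_zero ?_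
  rw [integral_abs_rpow_mul_exp_neg_mul_sq hb hc]
  exact (mul_pos (rpow_pos_of_pos hb _) (Gamma_pos_of_pos (by linarith))).ne'

theorem abs_rpow_mul_pow_two_mul {a : ℝ} (ha : 0 < a) (x : ℝ) (k : ℕ) :
    |x| ^ a * x ^ (2 * k) = |x| ^ (a + 2 * k) := by
  rw [rpow_add_of_nonneg (abs_nonneg x) ha.le (by positivity),
    show (2 : ℝ) * k = ((2 * k : ℕ) : ℝ) by push_cast; rfl, rpow_natCast, (even_two_mul k).pow_abs]

/-- Truncating the power series of `cosh` bounds absolute moments of an exponential of a quadratic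
form from below. -/
theorem sum_le_integral_abs_rpow_mul_exp {a b β γ d : ℝ} (ha : 0 < a) (hb : 0 < b) (hβ : 0 < β)
    (hγ : 0 < γ)
    (hInt : Integrable fun z : ℝ × ℝ => (|z.1| ^ a * exp (-β * z.1 ^ 2)) *
      (|z.2| ^ b * exp (-γ * z.2 ^ 2)) * exp (d * (z.1 * z.2))) (n : ℕ) :
    ∑ k ∈ range n, d ^ (2 * k) / (2 * k).factorial *
      ((∫ x : ℝ, |x| ^ (a + 2 * k) * exp (-β * x ^ 2)) *
        ∫ y : ℝ, |y| ^ (b + 2 * k) * exp (-γ * y ^ 2)) ≤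
      ∫ z : ℝ × ℝ, (|z.1| ^ a * exp (-β * z.1 ^ 2)) *
        (|z.2| ^ b * exp (-γ * z.2 ^ 2)) * exp (d * (z.1 * z.2)) := by
  set F : ℝ × ℝ → ℝ := fun z => (|z.1| ^ a * exp (-β * z.1 ^ 2)) *
      (|z.2| ^ b * exp (-γ * z.2 ^ 2)) * exp (d * (z.1 * z.2)) with hF
  have hmp : MeasurePreserving
      ((MeasurableEquiv.neg ℝ).prodCongr (MeasurableEquiv.refl ℝ)) volume volume :=
    (Measure.measurePreserving_neg (volume : Measure ℝ)).prod (MeasurePreserving.id volume)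
  have hsymm : ∫ z : ℝ × ℝ, F (-z.1, z.2) = ∫ z, F z := hmp.integral_comp' F
  have hInt' : Integrable fun z : ℝ × ℝ => F (-z.1, z.2) := (hmp.integrable_comp_emb (MeasurableEquiv.measurableEmbedding _)).2 hInt
  have hterm : ∀ k ∈ range n, Integrable fun z : ℝ × ℝ => d ^ (2 * k) / (2 * k).factorial *
      ((|z.1| ^ (a + 2 * k) * exp (-β * z.1 ^ 2)) *
        (|z.2| ^ (b + 2 * k) * exp (-γ * z.2 ^ 2))) := fun k _ => by
    have hk : (0 : ℝ) ≤ k := k.cast_nonneg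
    exact ((integrable_abs_rpow_mul_exp_neg_mul_sq hβ (by linarith)).mul_prod
      (integrable_abs_rpow_mul_exp_neg_mul_sq hγ (by linarith))).const_mul _
  have hsum : ∑ k ∈ range n, d ^ (2 * k) / (2 * k).factorial *
      ((∫ x : ℝ, |x| ^ (a + 2 * k) * exp (-β * x ^ 2)) *
        ∫ y : ℝ, |y| ^ (b + 2 * k) * exp (-γ * y ^ 2)) =
      ∫ z : ℝ × ℝ, ∑ k ∈ range n, d ^ (2 * k) / (2 * k).factorial *
        ((|z.1| ^ (a + 2 * k) * exp (-β * z.1 ^ 2)) *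
          (|z.2| ^ (b + 2 * k) * exp (-γ * z.2 ^ 2))) := by
    rw [integral_finsetSum _ hterm]
    refine sum_congr rfl fun k _ => ?_
    rw [integral_const_mul, Measure.volume_eq_prod, integral_prod_mul
      (fun x : ℝ => |x| ^ (a + 2 * k) * exp (-β * x ^ 2))
      (fun y : ℝ => |y| ^ (b + 2 * k) * exp (-γ * y ^ 2))]
  have havg : ∫ z, F z = ∫ z : ℝ × ℝ, (F z + F (-z.1, z.2)) / 2 := by
    rw [integral_div, integral_add hInt hInt', hsymm]
    ring
  rw [hsum, havg]
  refine integral_mono (integrable_finsetSum _ hterm) ((hInt.add hInt').div_const 2) fun z => ?_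
  have hcosh : (F z + F (-z.1, z.2)) / 2 = (|z.1| ^ a * exp (-β * z.1 ^ 2)) *
      (|z.2| ^ b * exp (-γ * z.2 ^ 2)) * cosh (d * (z.1 * z.2)) := by
    simp only [hF, abs_neg, neg_sq, cosh_eq, neg_mul, mul_neg]
    ring
  change _ ≤ (F z + F (-z.1, z.2)) / 2
  rw [hcosh]
  have hle := sum_le_hasSum (range n) (fun k _ => div_nonneg
    ((even_two_mul k).pow_nonneg (d * (z.1 * z.2))) (Nat.cast_nonneg _))
    (hasSum_cosh (d * (z.1 * z.2)))
  refine le_trans (le_of_eq ?_) (mul_le_mul_of_nonneg_left hle (by positivity))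
  rw [mul_sum]
  refine sum_congr rfl fun k _ => ?_
  rw [← abs_rpow_mul_pow_two_mul ha, ← abs_rpow_mul_pow_two_mul hb]
  ring

theorem E1_eq {σ a : ℝ} (hσ : 0 < σ) (ha : 0 < a) :
    E1 σ a = 2 ^ (a / 2) * σ ^ a / √π * Gamma ((a + 1) / 2) := by
  have hb : 0 < 1 / (2 * σ ^ 2) := by positivity
  have h := integral_abs_rpow_mul_exp_neg_mul_sq hb (by linarith : -1 < a)
  have hrw : E1 σ a = (√(2 * π * σ ^ 2))⁻¹ *
      ∫ x : ℝ, |x| ^ a * exp (-(1 / (2 * σ ^ 2)) * x ^ 2) := by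
    rw [E1, ← integral_const_mul]
    congr 1 with x
    rw [show -x ^ 2 / (2 * σ ^ 2) = -(1 / (2 * σ ^ 2)) * x ^ 2 by ring]
    ring
  have hpow : (1 / (2 * σ ^ 2)) ^ (-((a + 1) / 2)) = 2 ^ (a / 2) * √2 * (σ ^ a * σ) := by
    rw [rpow_neg hb.le, one_div, inv_rpow (by positivity), inv_inv,
      mul_rpow (by norm_num) (by positivity), ← rpow_natCast, ← rpow_mul hσ.le, sqrt_eq_rpow,
      ← rpow_add two_pos, ← rpow_add_one hσ.ne']
    congr 2 <;> push_cast <;> ring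
  have hsq : √(2 * π * σ ^ 2) = √2 * √π * σ := by
    rw [sqrt_mul (by positivity), sqrt_mul (by norm_num), sqrt_sq hσ.le]
  rw [hrw, h, hpow, hsq]
  have := sqrt_pos.2 pi_pos
  have : 0 < √(2 : ℝ) := by positivity
  field_simp

/-- The Gaussian density as a product of centered Gaussians and a mixed exponential. -/
theorem gaussDensity2_eq {σ₁ σ₂ ρ : ℝ} (hσ₁ : 0 < σ₁) (hσ₂ : 0 < σ₂) (hw : 0 < 1 - ρ ^ 2)
    (x y : ℝ) :
    gaussDensity2 σ₁ σ₂ ρ x y = (2 * π * σ₁ * σ₂ * √(1 - ρ ^ 2))⁻¹ *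
      (exp (-(1 / (2 * σ₁ ^ 2 * (1 - ρ ^ 2))) * x ^ 2) *
        exp (-(1 / (2 * σ₂ ^ 2 * (1 - ρ ^ 2))) * y ^ 2) *
        exp (ρ / (σ₁ * σ₂ * (1 - ρ ^ 2)) * (x * y))) := by
  rw [gaussDensity2, ← exp_add, ← exp_add]
  congr 2
  field_simp
  ring

theorem integrable_abs_rpow_mul_exp_mul_exp {σ₁ σ₂ ρ a b : ℝ} (hσ₁ : 0 < σ₁) (hσ₂ : 0 < σ₂)
    (hρ : |ρ| < 1) (hw : 0 < 1 - ρ ^ 2) (ha : 0 < a) (hb : 0 < b) :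
    Integrable fun z : ℝ × ℝ =>
      (|z.1| ^ a * exp (-(1 / (2 * σ₁ ^ 2 * (1 - ρ ^ 2))) * z.1 ^ 2)) *
      (|z.2| ^ b * exp (-(1 / (2 * σ₂ ^ 2 * (1 - ρ ^ 2))) * z.2 ^ 2)) *
      exp (ρ / (σ₁ * σ₂ * (1 - ρ ^ 2)) * (z.1 * z.2)) := by
  have h1 : 0 < 1 - |ρ| := by linarith
  have hbase := (integrable_abs_rpow_mul_exp_neg_mul_sq
    (b := (1 - |ρ|) * (1 / (2 * σ₁ ^ 2 * (1 - ρ ^ 2)))) (c := a) (by positivity)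
    (by linarith)).mul_prod (integrable_abs_rpow_mul_exp_neg_mul_sq
    (b := (1 - |ρ|) * (1 / (2 * σ₂ ^ 2 * (1 - ρ ^ 2)))) (c := b) (by positivity)
    (by linarith))
  refine hbase.mono' (by measurability) (Eventually.of_forall fun z => ?_)
  have hle : ρ / (σ₁ * σ₂ * (1 - ρ ^ 2)) * (z.1 * z.2) ≤
      |ρ| * (1 / (2 * σ₁ ^ 2 * (1 - ρ ^ 2)) * z.1 ^ 2 +
        1 / (2 * σ₂ ^ 2 * (1 - ρ ^ 2)) * z.2 ^ 2) := by
    have h2 : ρ * (z.1 / σ₁ * (z.2 / σ₂)) ≤ |ρ| * (((z.1 / σ₁) ^ 2 + (z.2 / σ₂) ^ 2) / 2) := by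
      refine (le_abs_self _).trans ?_
      rw [abs_mul]
      refine mul_le_mul_of_nonneg_left ?_ (abs_nonneg ρ)
      rw [abs_le]
      constructor
      · nlinarith [sq_nonneg (z.1 / σ₁ + z.2 / σ₂)]
      · nlinarith [sq_nonneg (z.1 / σ₁ - z.2 / σ₂)]
    calc _ = ρ * (z.1 / σ₁ * (z.2 / σ₂)) / (1 - ρ ^ 2) := by field_simp
      _ ≤ |ρ| * (((z.1 / σ₁) ^ 2 + (z.2 / σ₂) ^ 2) / 2) / (1 - ρ ^ 2) :=
        div_le_div_of_nonneg_right h2 hw.le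
      _ = _ := by field_simp
  rw [norm_of_nonneg (by positivity)]
  have hexp : ∀ u v A B m : ℝ, (A * exp u) * (B * exp v) * exp m = A * B * exp (u + v + m) := by
    intro u v A B m
    rw [exp_add, exp_add]
    ring
  rw [hexp, mul_mul_mul_comm, ← exp_add]
  refine mul_le_mul_of_nonneg_left (exp_le_exp.2 ?_) (by positivity)
  linarith

theorem normalization_eq {σ₁ σ₂ w a b : ℝ} (hσ₁ : 0 < σ₁) (hσ₂ : 0 < σ₂) (hw : 0 < w) :
    (2 * π * σ₁ * σ₂ * √w)⁻¹ * ((1 / (2 * σ₁ ^ 2 * w)) ^ (-((a + 1) / 2)) *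
      (1 / (2 * σ₂ ^ 2 * w)) ^ (-((b + 1) / 2))) =
      2 ^ ((a + b) / 2) * σ₁ ^ a * σ₂ ^ b / π * w ^ ((a + b - 1) / 2 + 1) := by
  have hpow : ∀ σ c : ℝ, 0 < σ → (1 / (2 * σ ^ 2 * w)) ^ (-((c + 1) / 2)) =
      2 ^ (c / 2) * √2 * (σ ^ c * σ) * w ^ ((c + 1) / 2) := by
    intro σ c hσ
    rw [rpow_neg (by positivity), one_div, inv_rpow (by positivity), inv_inv,
      mul_rpow (by positivity) hw.le, mul_rpow (by norm_num) (by positivity), ← rpow_natCast,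
      ← rpow_mul hσ.le, sqrt_eq_rpow, ← rpow_add two_pos, ← rpow_add_one hσ.ne']
    congr 3 <;> push_cast <;> ring
  have h2 : (2 : ℝ) ^ ((a + b) / 2) = 2 ^ (a / 2) * 2 ^ (b / 2) := by
    rw [← rpow_add two_pos]; congr 1; ring
  have h3 : w ^ ((a + 1) / 2) * w ^ ((b + 1) / 2) = w ^ ((a + b - 1) / 2 + 1) * √w := by
    rw [sqrt_eq_rpow, ← rpow_add hw, ← rpow_add hw]; congr 1; ring
  have h4 : √2 * √2 = (2 : ℝ) := mul_self_sqrt (by norm_num)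
  rw [hpow σ₁ a hσ₁, hpow σ₂ b hσ₂, h2]
  have := sqrt_pos.2 hw
  have := pi_pos
  generalize w ^ ((a + b - 1) / 2 + 1) = W at *
  field_simp
  rw [sq, h4]
  linear_combination (2 : ℝ) * h3

theorem sum_le_E2 {σ₁ σ₂ ρ a b : ℝ} (hσ₁ : 0 < σ₁) (hσ₂ : 0 < σ₂) (hρ : |ρ| < 1)
    (ha : 0 < a) (hb : 0 < b) (n : ℕ) :
    2 ^ ((a + b) / 2) * σ₁ ^ a * σ₂ ^ b / π * (1 - ρ ^ 2) ^ ((a + b - 1) / 2 + 1) *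
      ∑ k ∈ range n, Gamma ((a + 1) / 2 + k) * Gamma ((b + 1) / 2 + k) * 4 ^ k /
        (2 * k).factorial * (ρ ^ 2) ^ k ≤ E2 σ₁ σ₂ ρ a b := by
  have hw : 0 < 1 - ρ ^ 2 := by linarith [(sq_lt_one_iff_abs_lt_one ρ).2 hρ]
  set β := 1 / (2 * σ₁ ^ 2 * (1 - ρ ^ 2)) with hβd
  set γ := 1 / (2 * σ₂ ^ 2 * (1 - ρ ^ 2)) with hγd
  set d := ρ / (σ₁ * σ₂ * (1 - ρ ^ 2)) with hd
  have hβ : 0 < β := by positivity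
  have hγ : 0 < γ := by positivity
  have hE : E2 σ₁ σ₂ ρ a b = (2 * π * σ₁ * σ₂ * √(1 - ρ ^ 2))⁻¹ *
      ∫ z : ℝ × ℝ, (|z.1| ^ a * exp (-β * z.1 ^ 2)) *
        (|z.2| ^ b * exp (-γ * z.2 ^ 2)) * exp (d * (z.1 * z.2)) := by
    rw [E2, ← integral_const_mul]
    congr 1 with z
    rw [gaussDensity2_eq hσ₁ hσ₂ hw]
    ring
  have hsum := sum_le_integral_abs_rpow_mul_exp ha hb hβ hγ
    (integrable_abs_rpow_mul_exp_mul_exp hσ₁ hσ₂ hρ hw ha hb) n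
  rw [hE, ← normalization_eq hσ₁ hσ₂ hw, ← hβd, ← hγd, mul_assoc]
  refine mul_le_mul_of_nonneg_left (le_trans (le_of_eq ?_) hsum) (by positivity)
  rw [mul_sum]
  refine sum_congr rfl fun k _ => ?_
  have hk : (0 : ℝ) ≤ k := k.cast_nonneg
  have hsplit : ∀ v c : ℝ, 0 < v → v ^ (-((c + 2 * k + 1) / 2)) = v ^ (-((c + 1) / 2)) / v ^ k := by
    intro v c hv
    rw [← rpow_natCast, ← rpow_sub hv]
    congr 1
    ring
  have hd2 : d ^ (2 * k) = 4 ^ k * (ρ ^ 2) ^ k * (β ^ k * γ ^ k) := by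
    rw [pow_mul, ← mul_pow, ← mul_pow, ← mul_pow]
    congr 1
    rw [hd, hβd, hγd]
    field_simp
    norm_num
  rw [integral_abs_rpow_mul_exp_neg_mul_sq hβ (by linarith),
    integral_abs_rpow_mul_exp_neg_mul_sq hγ (by linarith), hsplit β a hβ, hsplit γ b hγ, hd2,
    show (a + 2 * k + 1) / 2 = (a + 1) / 2 + k by ring,
    show (b + 2 * k + 1) / 2 = (b + 1) / 2 + k by ring]
  clear_value β γ d
  field_simp

theorem gpi_quantitative_mixed_range (σ₁ σ₂ ρ α₁ α₂ : ℝ)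
    (hσ₁ : 0 < σ₁) (hσ₂ : 0 < σ₂) (hρ : ρ ∈ Set.Ioo (-1 : ℝ) 1)
    (hα : (2 < α₁ ∧ 0 < α₂ ∧ α₂ < 2) ∨ (0 < α₁ ∧ α₁ < 2 ∧ 2 < α₂)) :
    E2 σ₁ σ₂ ρ α₁ α₂ - E1 σ₁ α₁ * E1 σ₂ α₂ ≥
      2 ^ ((α₁ + α₂) / 2) * α₁ * α₂ * σ₁ ^ α₁ * σ₂ ^ α₂ * ρ ^ 2 /
        (4 * Real.sqrt π) * Real.Gamma ((α₁ + α₂ - 1) / 2) := by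
  have ha : 0 < α₁ := by rcases hα with h | h <;> linarith [h.1]
  have hb : 0 < α₂ := by rcases hα with h | h <;> linarith [h.2.1, h.2.2]
  have hρ' : |ρ| < 1 := abs_lt.2 hρ
  have ht : |ρ ^ 2| < 1 := by
    rw [abs_of_nonneg (sq_nonneg ρ)]; exact (sq_lt_one_iff_abs_lt_one ρ).2 hρ'
  have hw : 0 < 1 - ρ ^ 2 := by linarith [(abs_lt.1 ht).2]
  have hs : 0 < (α₁ + α₂ - 1) / 2 := by rcases hα with h | h <;> linarith [h.1, h.2.1, h.2.2]
  have hpq : ((α₁ + 1) / 2 - 3 / 2) * ((α₂ + 1) / 2 - 3 / 2) < 0 := by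
    rcases hα with h | h
    · exact mul_neg_of_pos_of_neg (by linarith [h.1]) (by linarith [h.2.2])
    · exact mul_neg_of_neg_of_pos (by linarith [h.2.1]) (by linarith [h.2.2])
  have hcoeff := coeff_le_Gamma_mul_Gamma (p := (α₁ + 1) / 2) (q := (α₂ + 1) / 2)
    (by linarith) (by linarith) hpq hs (by ring)
  have hlim := (hasSum_coeff hs (Gamma ((α₁ + 1) / 2) * Gamma ((α₂ + 1) / 2))
    (√π * (((α₁ + 1) / 2 - 1 / 2) * ((α₂ + 1) / 2 - 1 / 2)) * Gamma ((α₁ + α₂ - 1) / 2))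
    ht).tendsto_sum_nat
  have hE := le_of_tendsto' (hlim.const_mul (2 ^ ((α₁ + α₂) / 2) * σ₁ ^ α₁ * σ₂ ^ α₂ / π *
    (1 - ρ ^ 2) ^ ((α₁ + α₂ - 1) / 2 + 1))) fun n =>
      (mul_le_mul_of_nonneg_left (Finset.sum_le_sum fun k _ =>
        mul_le_mul_of_nonneg_right (hcoeff k) (by positivity)) (by positivity)).trans
      (sum_le_E2 hσ₁ hσ₂ hρ' ha hb n)
  have hcancel : (1 - ρ ^ 2) ^ ((α₁ + α₂ - 1) / 2 + 1) *
      (1 - ρ ^ 2) ^ (-((α₁ + α₂ - 1) / 2 + 1)) = 1 := by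
    rw [← rpow_add hw, add_neg_cancel, rpow_zero]
  have hsq : √π * √π = π := mul_self_sqrt pi_pos.le
  have hsqpos : 0 < √π := sqrt_pos.2 pi_pos
  rw [ge_iff_le, le_sub_iff_add_le]
  refine le_trans (le_of_eq ?_) hE
  rw [mul_mul_mul_comm, hcancel, mul_one, E1_eq hσ₁ ha, E1_eq hσ₂ hb,
    show (α₁ + α₂) / 2 = α₁ / 2 + α₂ / 2 by ring, rpow_add two_pos]
  generalize √π = r at *
  rw [← hsq]
  field_simp
  ring
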